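/- Reduction lemma: let L1, L2, L3 be Lagrangian subspaces of a real symplectic vector space (E, ω) and let K be any subspace of L1∩L2 + L2∩L3 + L3∩L1. Then C := K + K^ω contains K ∩ K^ω as the radical of the restriction of ω to C, so ω induces a nondegenerate alternating bilinear form ω^K on the quotient E^K := C/(K ∩ K^ω); the images L_i^K := ((L_i ∩ C) + (K ∩ K^ω))/(K ∩ K^ω) of the L_i under the reduction are Lagrangian subspaces of (E^K, ω^K), and s(L1,L2,L3) = s(L1^K, L2^K, L3^K), where the right-hand side is the signature of the triplet in (E^K, ω^K). -/

import Mathlib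

open LinearMap (BilinForm)

variable {E : Type*} [AddCommGroup E] [Module ℝ E]

/-- A subspace is Lagrangian iff it equals its symplectic orthogonal. -/
def IsLagrangian (ω : BilinForm ℝ E) (L : Submodule ℝ E) : Prop :=
  LinearMap.BilinForm.orthogonal ω L = L

/-- Maximal dimension of a subspace on which the function `Q` is positive away from `0`. -/
noncomputable def posIndex {V : Type*} [AddCommGroup V] [Module ℝ V] (Q : V → ℝ) : ℕ :=
  sSup {d : ℕ | ∃ W : Submodule ℝ V, Module.finrank ℝ W = d ∧ ∀ x ∈ W, x ≠ 0 → 0 < Q x}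

/-- The quadratic form `Q(L1,L2,L3)` of a triplet of subspaces,
`Q(x1,x2,x3) = ω(x1,x2) + ω(x2,x3) + ω(x3,x1)`. -/
def tripleQ (ω : BilinForm ℝ E) (L1 L2 L3 : Submodule ℝ E) (v : L1 × L2 × L3) : ℝ :=
  ω v.1 v.2.1 + ω v.2.1 v.2.2 + ω v.2.2 v.1

/-- The signature `s(L1,L2,L3)` of a triplet of subspaces:  the signature (number of positive
squares minus number of negative squares in a diagonalization) of `Q(L1,L2,L3)`, computed as the
maximal dimension of a subspace on which the form is positive definite minus the maximal dimension
of a subspace on which it is negative definite. -/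
noncomputable def tripleSig (ω : BilinForm ℝ E) (L1 L2 L3 : Submodule ℝ E) : ℤ :=
  (posIndex (tripleQ ω L1 L2 L3) : ℤ) - (posIndex (fun v => - tripleQ ω L1 L2 L3 v) : ℤ)

section Index

variable {V W : Type*} [AddCommGroup V] [Module ℝ V] [AddCommGroup W] [Module ℝ W]

lemma bddAbove_finrank_pos [FiniteDimensional ℝ V] (Q : V → ℝ) :
    BddAbove {d : ℕ | ∃ W : Submodule ℝ V, Module.finrank ℝ W = d ∧ ∀ x ∈ W, x ≠ 0 → 0 < Q x} :=
  ⟨Module.finrank ℝ V, by rintro _ ⟨W, rfl, -⟩; exact W.finrank_le⟩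

lemma exists_finrank_eq_posIndex [FiniteDimensional ℝ V] (Q : V → ℝ) :
    ∃ W : Submodule ℝ V, Module.finrank ℝ W = posIndex Q ∧ ∀ x ∈ W, x ≠ 0 → 0 < Q x :=
  Nat.sSup_mem (s := {d : ℕ | ∃ W : Submodule ℝ V, Module.finrank ℝ W = d ∧
    ∀ x ∈ W, x ≠ 0 → 0 < Q x}) ⟨0, ⊥, by simp, by simp⟩ (bddAbove_finrank_pos Q)

lemma finrank_le_posIndex [FiniteDimensional ℝ V] {Q : V → ℝ} (h0 : Q 0 = 0)
    (f : W →ₗ[ℝ] V) (hf : ∀ x, x ≠ 0 → 0 < Q (f x)) : Module.finrank ℝ W ≤ posIndex Q := by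
  have hinj : Function.Injective f := by
    rw [← LinearMap.ker_eq_bot, LinearMap.ker_eq_bot']
    intro x hx
    by_contra hne
    have := hf x hne
    simp [hx, h0] at this
  refine le_csSup (bddAbove_finrank_pos Q) ⟨LinearMap.range f, LinearMap.finrank_range_of_inj hinj, ?_⟩
  rintro _ ⟨x, rfl⟩ hx
  exact hf x fun h => hx (by simp [h])

lemma posIndex_eq_of_surjective [FiniteDimensional ℝ V] [FiniteDimensional ℝ W]
    {Q : V → ℝ} {Q' : W → ℝ} (h0 : Q' 0 = 0) (f : V →ₗ[ℝ] W)
    (hf : Function.Surjective f) (hQ : ∀ x, Q' (f x) = Q x) : posIndex Q = posIndex Q' := by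
  have h0' : Q 0 = 0 := by rw [← hQ, map_zero, h0]
  apply le_antisymm
  · obtain ⟨U, hU, hpos⟩ := exists_finrank_eq_posIndex Q
    rw [← hU]
    refine finrank_le_posIndex h0 (f ∘ₗ U.subtype) fun x hx => ?_
    simpa [hQ] using hpos x x.2 (by simpa using hx)
  · obtain ⟨U, hU, hpos⟩ := exists_finrank_eq_posIndex Q'
    obtain ⟨g, hg⟩ := f.exists_rightInverse_of_surjective (LinearMap.range_eq_top.2 hf)
    rw [← hU]
    refine finrank_le_posIndex h0' (g ∘ₗ U.subtype) fun x hx => ?_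
    have hfg : f (g x) = x := LinearMap.congr_fun hg x
    simpa [← hQ, hfg] using hpos x x.2 (by simpa using hx)

/-- The positive index drops by one on the orthogonal of an isotropic vector
outside the radical. -/
lemma posIndex_eq_ker_add_one [FiniteDimensional ℝ V] (B : BilinForm ℝ V) (hB : B.IsSymm)
    {e : V} (he : B e e = 0) (hne : B e ≠ 0) :
    posIndex (fun x => B x x) = posIndex (fun x : LinearMap.ker (B e) => B x x) + 1 := by
  apply le_antisymm
  · obtain ⟨U, hU, hpos⟩ := exists_finrank_eq_posIndex fun x => B x x
    have h1 := LinearMap.finrank_range_add_finrank_ker (B e ∘ₗ U.subtype)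
    have h2 : Module.finrank ℝ (LinearMap.range (B e ∘ₗ U.subtype)) ≤ 1 := by
      simpa using (LinearMap.range (B e ∘ₗ U.subtype)).finrank_le
    have h3 : Module.finrank ℝ (LinearMap.ker (B e ∘ₗ U.subtype)) ≤
        posIndex (fun x : LinearMap.ker (B e) => B x x) := by
      refine finrank_le_posIndex (by simp)
        (LinearMap.codRestrict _ (U.subtype ∘ₗ Submodule.subtype _) fun x => x.2) fun x hx => ?_
      exact hpos x x.1.2 (by simpa using hx)
    omega
  · obtain ⟨U, hU, hpos⟩ := exists_finrank_eq_posIndex fun x : LinearMap.ker (B e) => B x x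
    obtain ⟨f, hf⟩ : ∃ f, B e f ≠ 0 := by
      by_contra! h
      exact hne (LinearMap.ext h)
    have hsymm : ∀ x y, B x y = B y x := hB.eq
    have hrefl : B.IsRefl := hB.isRefl
    let U' := U.map (LinearMap.ker (B e)).subtype
    have hU'e : ∀ u ∈ U', B e u = 0 := by
      rintro _ ⟨u, -, rfl⟩
      exact u.2
    have hU' : ∀ u ∈ U', u ≠ 0 → 0 < B u u := by
      rintro _ ⟨u, hu, rfl⟩ h
      exact hpos u hu (by simpa using h)
    have hdisj : Disjoint U' (LinearMap.BilinForm.orthogonal B U') := by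
      rw [Submodule.disjoint_def]
      intro x hx hx'
      by_contra h
      exact (hU' x hx h).ne' (hx' x hx)
    have hcompl := LinearMap.BilinForm.isCompl_orthogonal_of_restrict_nondegenerate hrefl
      (B.nondegenerate_restrict_of_disjoint_orthogonal hrefl hdisj)
    obtain ⟨w, hw, g, hg, rfl⟩ := Submodule.mem_sup.1
      (hcompl.sup_eq_top ▸ Submodule.mem_top : f ∈ U' ⊔ LinearMap.BilinForm.orthogonal B U')
    have hg' : B e g ≠ 0 := by simpa [hU'e w hw] using hf
    let h := g + ((1 - B g g) / (2 * B e g)) • e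
    have hhh : B h h = 1 := by
      simp only [h, map_add, map_smul, LinearMap.add_apply, LinearMap.smul_apply, smul_eq_mul, he,
        hsymm g e]
      field_simp
      ring
    have hUh : ∀ u ∈ U', B u h = 0 := by
      intro u hu
      have h1 : B u g = 0 := hg u hu
      simp [h, h1, hsymm u e, hU'e u hu]
    rw [← hU]
    have key := finrank_le_posIndex (Q := fun x => B x x) (by simp)
      (LinearMap.coprod ((LinearMap.ker (B e)).subtype ∘ₗ U.subtype)
        (LinearMap.toSpanSingleton ℝ V h)) (W := U × ℝ) ?_
    · simpa using key
    · rintro ⟨u, s⟩ hus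
      have hu : ((u : LinearMap.ker (B e)) : V) ∈ U' := Submodule.mem_map_of_mem u.2
      have hval : B (u + s • h) (u + s • h) = B u u + s ^ 2 := by
        simp only [map_add, map_smul, LinearMap.add_apply, LinearMap.smul_apply, smul_eq_mul, hhh,
          hUh _ hu, hsymm h u]
        ring
      have hnn : 0 ≤ B (u : V) u := by
        by_cases hu0 : ((u : LinearMap.ker (B e)) : V) = 0
        · simp [hu0]
        · exact (hU' _ hu hu0).le
      simp only [LinearMap.coprod_apply, LinearMap.comp_apply, Submodule.subtype_apply,
        LinearMap.toSpanSingleton_apply, hval]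
      by_cases hs : s = 0
      · have hu0 : ((u : LinearMap.ker (B e)) : V) ≠ 0 := by
          intro hu0
          exact hus (by simpa [hs] using hu0)
        have := hU' _ hu hu0
        positivity
      · positivity

/-- The signature of a quadratic function. -/
noncomputable def indexDiff (Q : V → ℝ) : ℤ :=
  (posIndex Q : ℤ) - (posIndex (fun v => - Q v) : ℤ)

lemma indexDiff_eq_of_surjective [FiniteDimensional ℝ V] [FiniteDimensional ℝ W]
    {Q : V → ℝ} {Q' : W → ℝ} (h0 : Q' 0 = 0) (f : V →ₗ[ℝ] W)
    (hf : Function.Surjective f) (hQ : ∀ x, Q' (f x) = Q x) : indexDiff Q = indexDiff Q' := by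
  unfold indexDiff
  rw [posIndex_eq_of_surjective h0 f hf hQ, posIndex_eq_of_surjective
    (Q := fun v => - Q v) (Q' := fun v => - Q' v) (by simp [h0]) f hf (by simp [hQ])]

lemma indexDiff_ker_of_isotropic [FiniteDimensional ℝ V] (B : BilinForm ℝ V) (hB : B.IsSymm)
    {e : V} (he : B e e = 0) :
    indexDiff (fun x : LinearMap.ker (B e) => B x x) = indexDiff (fun x => B x x) := by
  by_cases hne : B e = 0
  · refine indexDiff_eq_of_surjective (by simp) (LinearMap.ker (B e)).subtype ?_ fun _ => rfl
    exact fun x => ⟨⟨x, by simp [hne]⟩, rfl⟩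
  · have h1 := posIndex_eq_ker_add_one B hB he hne
    have h2 := posIndex_eq_ker_add_one (-B) hB.neg (e := e) (by simpa using he)
      (by simpa using hne)
    have h3 : posIndex (fun x : LinearMap.ker ((-B) e) => (-B) x x) =
        posIndex (fun x : LinearMap.ker (B e) => - B x x) :=
      posIndex_eq_of_surjective (by simp)
        (LinearMap.codRestrict (LinearMap.ker (B e)) (LinearMap.ker ((-B) e)).subtype
          fun x => by simpa using x.2)
        (fun x => ⟨⟨x, by simp⟩, rfl⟩) (fun x => by simp)
    rw [h3] at h2
    simp only [LinearMap.neg_apply] at h2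
    unfold indexDiff
    rw [h1, h2]
    push_cast
    ring

lemma indexDiff_orthogonal_finset [FiniteDimensional ℝ V] (B : BilinForm ℝ V) (hB : B.IsSymm)
    (s : Finset V) (hs : ∀ e ∈ s, ∀ e' ∈ s, B e e' = 0) (N : Submodule ℝ V)
    (hN : ∀ x, x ∈ N ↔ ∀ e ∈ s, B e x = 0) :
    indexDiff (fun x : N => B x x) = indexDiff (fun x => B x x) := by
  classical
  induction s using Finset.induction_on generalizing N with
  | empty =>
    refine indexDiff_eq_of_surjective (by simp) N.subtype ?_ fun _ => rfl
    exact fun x => ⟨⟨x, by simp [hN]⟩, rfl⟩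
  | insert e s _ ih =>
    let M := LinearMap.BilinForm.orthogonal B (Submodule.span ℝ (s : Set V))
    have hM : ∀ x, x ∈ M ↔ ∀ e ∈ s, B e x = 0 := by
      intro x
      refine ⟨fun h a ha => h a (Submodule.subset_span ha), fun h a ha => ?_⟩
      have : Submodule.span ℝ (s : Set V) ≤ LinearMap.ker (B.flip x) :=
        Submodule.span_le.2 fun a ha => h a ha
      exact this ha
    rw [← ih (fun a ha b hb => hs a (by simp [ha]) b (by simp [hb])) M hM]
    have heM : e ∈ M := (hM e).2 fun a ha => hs a (by simp [ha]) e (by simp)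
    have hsymm : (B.restrict M).IsSymm := ⟨fun x y => hB.eq x y⟩
    have hstep := indexDiff_ker_of_isotropic (B.restrict M) hsymm (e := ⟨e, heM⟩)
      (hs e (by simp) e (by simp))
    refine Eq.trans (Eq.symm ?_) hstep
    refine indexDiff_eq_of_surjective (by simp)
      (LinearMap.codRestrict N (M.subtype ∘ₗ Submodule.subtype _) ?_) ?_ (fun _ => rfl)
    · intro x
      refine (hN _).2 fun a ha => ?_
      rcases Finset.mem_insert.1 ha with rfl | ha
      · exact x.2
      · exact (hM _).1 x.1.2 a ha
    · intro x
      have hx := (hN x).1 x.2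
      exact ⟨⟨⟨x, (hM _).2 fun a ha => hx a (by simp [ha])⟩, hx e (by simp)⟩, rfl⟩

/-- Passing to the orthogonal of a set of mutually orthogonal isotropic vectors
preserves the signature. -/
lemma indexDiff_orthogonal [FiniteDimensional ℝ V] (B : BilinForm ℝ V) (hB : B.IsSymm)
    (S : Set V) (hS : ∀ e ∈ S, ∀ e' ∈ S, B e e' = 0) (N : Submodule ℝ V)
    (hN : ∀ x, x ∈ N ↔ ∀ e ∈ S, B e x = 0) :
    indexDiff (fun x : N => B x x) = indexDiff (fun x => B x x) := by
  obtain ⟨s, hsS, hs⟩ := Submodule.fg_span_iff_fg_span_finset_subset S |>.1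
    (IsNoetherian.noetherian (Submodule.span ℝ S))
  refine indexDiff_orthogonal_finset B hB s (fun e he e' he' => hS e (hsS he) e' (hsS he')) N
    fun x => (hN x).trans ⟨fun h e he => h e (hsS he), fun h e he => ?_⟩
  have hle : Submodule.span ℝ (s : Set V) ≤ LinearMap.ker (B.flip x) :=
    Submodule.span_le.2 fun a ha => h a ha
  exact hle (hs ▸ Submodule.subset_span he)

end Index

lemma IsLagrangian.apply_eq_zero {ω : BilinForm ℝ E} {L : Submodule ℝ E} (h : IsLagrangian ω L)
    {x y : E} (hx : x ∈ L) (hy : y ∈ L) : ω x y = 0 := by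
  have hy' : y ∈ LinearMap.BilinForm.orthogonal ω L := by rwa [h]
  exact hy' x hx

/-- The symmetric bilinear form whose quadratic form is `tripleQ`. -/
noncomputable def tripleForm (ω : BilinForm ℝ E) (L1 L2 L3 : Submodule ℝ E) :
    BilinForm ℝ (L1 × L2 × L3) :=
  LinearMap.mk₂ ℝ (fun x y =>
    (ω x.1 y.2.1 + ω x.2.1 y.2.2 + ω x.2.2 y.1 + (ω y.1 x.2.1 + ω y.2.1 x.2.2 + ω y.2.2 x.1)) / 2)
    (fun x y z => by simp; ring) (fun c x y => by simp; ring)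
    (fun x y z => by simp; ring) (fun c x y => by simp; ring)

lemma tripleForm_apply (ω : BilinForm ℝ E) (L1 L2 L3 : Submodule ℝ E) (x y : L1 × L2 × L3) :
    tripleForm ω L1 L2 L3 x y =
    (ω x.1 y.2.1 + ω x.2.1 y.2.2 + ω x.2.2 y.1 +
      (ω y.1 x.2.1 + ω y.2.1 x.2.2 + ω y.2.2 x.1)) / 2 := rfl

lemma tripleForm_isSymm (ω : BilinForm ℝ E) (L1 L2 L3 : Submodule ℝ E) :
    (tripleForm ω L1 L2 L3).IsSymm :=
  ⟨fun x y => by simp only [tripleForm_apply]; ring⟩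

lemma tripleForm_self (ω : BilinForm ℝ E) (L1 L2 L3 : Submodule ℝ E) (x : L1 × L2 × L3) :
    tripleForm ω L1 L2 L3 x x = tripleQ ω L1 L2 L3 x := by
  rw [tripleForm_apply, tripleQ]; ring

/-- The signature of a Lagrangian triplet is computed by the components orthogonal to `K`. -/
lemma tripleSig_eq_indexDiff_orthogonal [FiniteDimensional ℝ E]
    (ω : BilinForm ℝ E) (halt : LinearMap.IsAlt ω) (L1 L2 L3 : Submodule ℝ E)
    (h1 : IsLagrangian ω L1) (h2 : IsLagrangian ω L2) (h3 : IsLagrangian ω L3)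
    (K : Submodule ℝ E) (hK : K ≤ (L1 ⊓ L2) ⊔ (L2 ⊓ L3) ⊔ (L3 ⊓ L1))
    (N : Submodule ℝ (L1 × L2 × L3))
    (hN : ∀ x, x ∈ N ↔ ∀ k ∈ K, ω k x.1 = 0 ∧ ω k x.2.1 = 0 ∧ ω k x.2.2 = 0) :
    tripleSig ω L1 L2 L3 = indexDiff fun x : N => tripleQ ω L1 L2 L3 x := by
  have hskew : ∀ x y, ω x y = - ω y x := fun x y => (halt.neg y x).symm
  let S : Set (L1 × L2 × L3) := {e | ∃ a ∈ L1 ⊓ L2, ∃ b ∈ L2 ⊓ L3, ∃ c ∈ L3 ⊓ L1, a + b + c ∈ K ∧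
    (((e.1 : E) = a ∧ (e.2.1 : E) = 0 ∧ (e.2.2 : E) = 0) ∨
     ((e.1 : E) = 0 ∧ (e.2.1 : E) = b ∧ (e.2.2 : E) = 0) ∨
     ((e.1 : E) = 0 ∧ (e.2.1 : E) = 0 ∧ (e.2.2 : E) = c))}
  have hSmem : ∀ e ∈ S, (e.1 : E) ∈ L2 ∧ (e.2.1 : E) ∈ L3 ∧ (e.2.2 : E) ∈ L1 := by
    rintro e ⟨a, ha, b, hb, c, hc, -, ⟨ea, eb, ec⟩ | ⟨ea, eb, ec⟩ | ⟨ea, eb, ec⟩⟩ <;>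
      rw [ea, eb, ec]
    · exact ⟨ha.2, zero_mem _, zero_mem _⟩
    · exact ⟨zero_mem _, hb.2, zero_mem _⟩
    · exact ⟨zero_mem _, zero_mem _, hc.2⟩
  have key := indexDiff_orthogonal (tripleForm ω L1 L2 L3) (tripleForm_isSymm ω L1 L2 L3) S ?_ N ?_
  · simp only [tripleForm_self] at key
    exact key.symm
  · intro e he e' he'
    obtain ⟨p1, p2, p3⟩ := hSmem e he
    obtain ⟨q1, q2, q3⟩ := hSmem e' he'
    rw [tripleForm_apply, h2.apply_eq_zero p1 e'.2.1.2, h3.apply_eq_zero p2 e'.2.2.2,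
      h1.apply_eq_zero p3 e'.1.2, h2.apply_eq_zero q1 e.2.1.2, h3.apply_eq_zero q2 e.2.2.2,
      h1.apply_eq_zero q3 e.1.2]
    simp
  · rintro ⟨⟨x, hx⟩, ⟨y, hy⟩, ⟨z, hz⟩⟩
    rw [hN]
    constructor
    · rintro h e ⟨a, ha, b, hb, c, hc, hk, hcases⟩
      obtain ⟨kx, ky, kz⟩ := h _ hk
      simp only [map_add, LinearMap.add_apply] at kx ky kz
      simp only [h1.apply_eq_zero ha.1 hx, h1.apply_eq_zero hc.2 hx, h2.apply_eq_zero ha.2 hy,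
        h2.apply_eq_zero hb.1 hy, h3.apply_eq_zero hb.2 hz, h3.apply_eq_zero hc.1 hz,
        zero_add, add_zero] at kx ky kz
      rcases hcases with ⟨ea, eb, ec⟩ | ⟨ea, eb, ec⟩ | ⟨ea, eb, ec⟩ <;>
        simp [tripleForm_apply, ea, eb, ec, hskew x, hskew y, hskew z, kx, ky, kz,
          h1.apply_eq_zero hc.2 hx, h2.apply_eq_zero ha.2 hy, h3.apply_eq_zero hb.2 hz]
    · intro h k hk
      obtain ⟨u, hu, c, hc, rfl⟩ := Submodule.mem_sup.1 (hK hk)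
      obtain ⟨a, ha, b, hb, rfl⟩ := Submodule.mem_sup.1 hu
      have e1 := h (⟨a, ha.1⟩, 0, 0) ⟨a, ha, b, hb, c, hc, hk, by simp⟩
      have e2 := h (0, ⟨b, hb.1⟩, 0) ⟨a, ha, b, hb, c, hc, hk, by simp⟩
      have e3 := h (0, 0, ⟨c, hc.1⟩) ⟨a, ha, b, hb, c, hc, hk, by simp⟩
      simp [tripleForm_apply, hskew x, hskew y, hskew z, h1.apply_eq_zero hc.2 hx,
        h2.apply_eq_zero ha.2 hy, h3.apply_eq_zero hb.2 hz] at e1 e2 e3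
      simp [h1.apply_eq_zero ha.1 hx, h1.apply_eq_zero hc.2 hx, h2.apply_eq_zero ha.2 hy,
        h2.apply_eq_zero hb.1 hy, h3.apply_eq_zero hb.2 hz, h3.apply_eq_zero hc.1 hz, e1, e2, e3]

/-- Vectors in pairwise intersections of Lagrangians are mutually orthogonal. -/
lemma sup_inf_le_orthogonal (ω : BilinForm ℝ E) {L1 L2 L3 : Submodule ℝ E}
    (h1 : IsLagrangian ω L1) (h2 : IsLagrangian ω L2) (h3 : IsLagrangian ω L3) {x y : E}
    (hx : x ∈ (L1 ⊓ L2) ⊔ (L2 ⊓ L3) ⊔ (L3 ⊓ L1)) (hy : y ∈ (L1 ⊓ L2) ⊔ (L2 ⊓ L3) ⊔ (L3 ⊓ L1)) :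
    ω x y = 0 := by
  obtain ⟨u, hu, c, hc, rfl⟩ := Submodule.mem_sup.1 hx
  obtain ⟨a, ha, b, hb, rfl⟩ := Submodule.mem_sup.1 hu
  obtain ⟨v, hv, c', hc', rfl⟩ := Submodule.mem_sup.1 hy
  obtain ⟨a', ha', b', hb', rfl⟩ := Submodule.mem_sup.1 hv
  simp [h1.apply_eq_zero ha.1 ha'.1, h2.apply_eq_zero ha.2 hb'.1, h1.apply_eq_zero ha.1 hc'.2,
    h2.apply_eq_zero hb.1 ha'.2, h2.apply_eq_zero hb.1 hb'.1, h3.apply_eq_zero hb.2 hc'.1,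
    h1.apply_eq_zero hc.2 ha'.1, h3.apply_eq_zero hc.1 hb'.2, h1.apply_eq_zero hc.2 hc'.2]

/-- The reduction of a Lagrangian along an isotropic subspace `K` is Lagrangian. -/
lemma isLagrangian_reduction [FiniteDimensional ℝ E]
    (ω : BilinForm ℝ E) (halt : LinearMap.IsAlt ω) (hnd : LinearMap.BilinForm.Nondegenerate ω)
    {L : Submodule ℝ E} (hL : IsLagrangian ω L) {K C : Submodule ℝ E}
    (hC : C = LinearMap.BilinForm.orthogonal ω K) (hKC : K ≤ C)
    (ωK : BilinForm ℝ (↥C ⧸ Submodule.comap C.subtype K))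
    (hωK : ∀ x y : C, ωK (Submodule.Quotient.mk x) (Submodule.Quotient.mk y) = ω x y) :
    IsLagrangian ωK (Submodule.map (Submodule.mkQ (Submodule.comap C.subtype K))
      (Submodule.comap C.subtype (L ⊓ C))) := by
  refine le_antisymm (fun z hz => ?_) ?_
  · obtain ⟨c, rfl⟩ := Submodule.mkQ_surjective _ z
    have hc : ∀ l ∈ L ⊓ C, ω l c = 0 := fun l hl =>
      (hωK ⟨l, hl.2⟩ c).symm.trans (hz _ (Submodule.mem_map_of_mem hl))
    have hle : LinearMap.BilinForm.orthogonal ω (L ⊔ K) ≤ L ⊓ C := by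
      refine le_inf ?_ ?_
      · exact (LinearMap.BilinForm.orthogonal_le le_sup_left).trans hL.le
      · rw [hC]
        exact LinearMap.BilinForm.orthogonal_le le_sup_right
    have hmem : (c : E) ∈ L ⊔ K := by
      rw [← LinearMap.BilinForm.orthogonal_orthogonal hnd halt.isRefl (L ⊔ K)]
      exact fun l hl => hc l (hle hl)
    obtain ⟨l, hl, k, hk, hlk⟩ := Submodule.mem_sup.1 hmem
    have hlC : l ∈ C := by
      rw [eq_sub_of_add_eq hlk]
      exact C.sub_mem c.2 (hKC hk)
    refine ⟨⟨l, hlC⟩, ⟨hl, hlC⟩, (Submodule.Quotient.eq _).2 ?_⟩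
    have : l - c = -k := by rw [← hlk]; abel
    simpa [this] using hk
  · rintro _ ⟨x, hx, rfl⟩ _ ⟨y, hy, rfl⟩
    exact (hωK y x).trans (hL.apply_eq_zero hy.1 hx.1)

/-- Reduction lemma: for `K ⊆ L1∩L2 + L2∩L3 + L3∩L1`, with `C = K + K^ω` and
`R = K ∩ K^ω`, the subspace `R` is the radical of the restriction of `ω` to `C`; the induced
nondegenerate alternating form `ω^K` on `E^K = C/R` makes the images `L_i^K = ((L_i∩C)+R)/R`
Lagrangian, and `s(L1,L2,L3) = s(L1^K,L2^K,L3^K)`. -/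
theorem reduction_lemma [FiniteDimensional ℝ E]
    (ω : BilinForm ℝ E) (halt : LinearMap.IsAlt ω)
    (hnd : LinearMap.BilinForm.Nondegenerate ω)
    (L1 L2 L3 : Submodule ℝ E)
    (h1 : IsLagrangian ω L1) (h2 : IsLagrangian ω L2) (h3 : IsLagrangian ω L3)
    (K : Submodule ℝ E) (hK : K ≤ (L1 ⊓ L2) ⊔ (L2 ⊓ L3) ⊔ (L3 ⊓ L1))
    (C R : Submodule ℝ E)
    (hC : C = K ⊔ LinearMap.BilinForm.orthogonal ω K)
    (hR : R = K ⊓ LinearMap.BilinForm.orthogonal ω K) :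
    -- `R` is the radical of the restriction of `ω` to `C`
    (∀ x : C, (∀ y : C, ω x y = 0) ↔ (x : E) ∈ R) ∧
    -- `ω` descends to a nondegenerate alternating form `ω^K` on `E^K = C/R` for which the
    -- reduced subspaces `L_i^K` are Lagrangian, with equality of signatures
    ∃ ωK : BilinForm ℝ (↥C ⧸ Submodule.comap C.subtype R),
      (∀ x y : C, ωK (Submodule.Quotient.mk x) (Submodule.Quotient.mk y) = ω x y) ∧
      LinearMap.IsAlt ωK ∧ LinearMap.BilinForm.Nondegenerate ωK ∧
      IsLagrangian ωK
        (Submodule.map (Submodule.mkQ (Submodule.comap C.subtype R))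
          (Submodule.comap C.subtype (L1 ⊓ C))) ∧
      IsLagrangian ωK
        (Submodule.map (Submodule.mkQ (Submodule.comap C.subtype R))
          (Submodule.comap C.subtype (L2 ⊓ C))) ∧
      IsLagrangian ωK
        (Submodule.map (Submodule.mkQ (Submodule.comap C.subtype R))
          (Submodule.comap C.subtype (L3 ⊓ C))) ∧
      tripleSig ω L1 L2 L3 =
        tripleSig ωK
          (Submodule.map (Submodule.mkQ (Submodule.comap C.subtype R))
            (Submodule.comap C.subtype (L1 ⊓ C)))
          (Submodule.map (Submodule.mkQ (Submodule.comap C.subtype R))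
            (Submodule.comap C.subtype (L2 ⊓ C)))
          (Submodule.map (Submodule.mkQ (Submodule.comap C.subtype R))
            (Submodule.comap C.subtype (L3 ⊓ C))) := by
  have hiso : ∀ x ∈ K, ∀ y ∈ K, ω x y = 0 := fun x hx y hy =>
    sup_inf_le_orthogonal ω h1 h2 h3 (hK hx) (hK hy)
  have hKo : K ≤ LinearMap.BilinForm.orthogonal ω K := fun y hy x hx => hiso x hx y hy
  rw [sup_eq_right.2 hKo] at hC
  rw [inf_eq_left.2 hKo] at hR
  subst hR
  have hKC : R ≤ C := hC ▸ hKo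
  have hCR : ∀ x ∈ C, ∀ k ∈ R, ω k x = 0 := fun x hx => by rwa [hC] at hx
  have hCR' : ∀ x ∈ C, ∀ k ∈ R, ω x k = 0 := fun x hx k hk => halt.isRefl _ _ (hCR x hx k hk)
  have hrad : ∀ x : C, (∀ y : C, ω x y = 0) ↔ (x : E) ∈ R := by
    refine fun x => ⟨fun h => ?_, fun h y => hCR y y.2 x h⟩
    rw [← LinearMap.BilinForm.orthogonal_orthogonal hnd halt.isRefl R, ← hC]
    exact fun y hy => halt.isRefl _ _ (h ⟨y, hy⟩)
  refine ⟨hrad, ?_⟩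
  let S := Submodule.comap C.subtype R
  let ω' : C →ₗ[ℝ] (C ⧸ S) →ₗ[ℝ] ℝ :=
    { toFun := fun x => S.liftQ (ω.restrict C x) fun k hk => hCR' x x.2 k hk
      map_add' := fun x y => by ext z; simp
      map_smul' := fun c x => by ext z; simp }
  let ωK : BilinForm ℝ (C ⧸ S) := S.liftQ ω' fun k hk => by
    ext z
    exact hCR z z.2 k hk
  have hωK : ∀ x y : C, ωK (Submodule.Quotient.mk x) (Submodule.Quotient.mk y) = ω x y :=
    fun x y => rfl
  have haltK : LinearMap.IsAlt ωK := by
    intro z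
    obtain ⟨x, rfl⟩ := Submodule.mkQ_surjective _ z
    exact halt x
  refine ⟨ωK, hωK, haltK, ?_, isLagrangian_reduction ω halt hnd h1 hC hKC ωK hωK,
    isLagrangian_reduction ω halt hnd h2 hC hKC ωK hωK,
    isLagrangian_reduction ω halt hnd h3 hC hKC ωK hωK, ?_⟩
  · refine (LinearMap.IsRefl.nondegenerate_iff_separatingLeft haltK.isRefl).2 fun z hz => ?_
    obtain ⟨x, rfl⟩ := Submodule.mkQ_surjective _ z
    exact (Submodule.Quotient.mk_eq_zero S).2 ((hrad x).1 fun y => hz (Submodule.Quotient.mk y))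
  · let N : Submodule ℝ (L1 × L2 × L3) :=
      (C.comap L1.subtype).prod ((C.comap L2.subtype).prod (C.comap L3.subtype))
    have hN : ∀ x, x ∈ N ↔ ∀ k ∈ R, ω k x.1 = 0 ∧ ω k x.2.1 = 0 ∧ ω k x.2.2 = 0 := by
      intro x
      simp only [N, Submodule.mem_prod, Submodule.mem_comap, Submodule.subtype_apply, hC,
        LinearMap.BilinForm.mem_orthogonal_iff]
      exact ⟨fun h k hk => ⟨h.1 k hk, h.2.1 k hk, h.2.2 k hk⟩,
        fun h => ⟨fun k hk => (h k hk).1, fun k hk => (h k hk).2.1, fun k hk => (h k hk).2.2⟩⟩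
    rw [tripleSig_eq_indexDiff_orthogonal ω halt L1 L2 L3 h1 h2 h3 R hK N hN]
    let proj (L : Submodule ℝ E) : C.comap L.subtype →ₗ[ℝ]
        (Submodule.comap C.subtype (L ⊓ C)).map S.mkQ :=
      (S.mkQ ∘ₗ (L.subtype ∘ₗ (C.comap L.subtype).subtype).codRestrict C
        fun x => x.2).codRestrict _ fun x =>
          Submodule.mem_map_of_mem ⟨x.1.2, x.2⟩
    have hproj : ∀ L, Function.Surjective (proj L) := by
      rintro L ⟨_, x, hx, rfl⟩
      exact ⟨⟨⟨x, hx.1⟩, x.2⟩, rfl⟩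
    let fst : N →ₗ[ℝ] C.comap L1.subtype :=
      (LinearMap.fst ℝ L1 (L2 × L3) ∘ₗ N.subtype).codRestrict _ fun x => x.2.1
    let snd : N →ₗ[ℝ] C.comap L2.subtype :=
      (LinearMap.fst ℝ L2 L3 ∘ₗ LinearMap.snd ℝ L1 (L2 × L3) ∘ₗ N.subtype).codRestrict _
        fun x => x.2.2.1
    let thd : N →ₗ[ℝ] C.comap L3.subtype :=
      (LinearMap.snd ℝ L2 L3 ∘ₗ LinearMap.snd ℝ L1 (L2 × L3) ∘ₗ N.subtype).codRestrict _
        fun x => x.2.2.2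
    refine indexDiff_eq_of_surjective (by simp [tripleQ])
      ((proj L1 ∘ₗ fst).prod ((proj L2 ∘ₗ snd).prod (proj L3 ∘ₗ thd))) ?_ fun _ => rfl
    rintro ⟨a, b, c⟩
    obtain ⟨x, rfl⟩ := hproj L1 a
    obtain ⟨y, rfl⟩ := hproj L2 b
    obtain ⟨z, rfl⟩ := hproj L3 c
    exact ⟨⟨(x.1, y.1, z.1), x.2, y.2, z.2⟩, rfl⟩
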